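/- Let T be a 4×4 real matrix with |T_{ij}| ≤ 1 for all i, j, viewed as a linear map ℝ⁴ → ℝ⁴, and let r > 1/2 satisfy r·C₄ ⊆ T(C₄*). Then for every sign vector ε ∈ {−1,1}⁴ there is exactly one row index i ∈ {1,2,3,4} with |Σⱼ εⱼ T_{ij}| ≥ 4r, and for every row index i there are exactly 4 sign vectors ε ∈ {−1,1}⁴ with |Σⱼ εⱼ T_{ij}| ≥ 4r. -/

import Mathlib

open Set Pointwise

noncomputable section

/-- The unit cube in `ℝⁿ`. -/
def cube (n : ℕ) : Set (Fin n → ℝ) := {x | ∀ i, |x i| ≤ 1}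

/-- The cross-polytope (unit ball of the `ℓ¹` norm) in `ℝⁿ`. -/
def crossPoly (n : ℕ) : Set (Fin n → ℝ) := {x | ∑ i, |x i| ≤ 1}

/-- A convex body: compact, convex, nonempty interior. -/
def IsConvexBody {n : ℕ} (K : Set (Fin n → ℝ)) : Prop :=
  Convex ℝ K ∧ IsCompact K ∧ (interior K).Nonempty

/-- A centrally symmetric set: symmetric about some point `c`. -/
def IsSymmetricBody {n : ℕ} (L : Set (Fin n → ℝ)) : Prop :=
  ∃ c : Fin n → ℝ, L = (fun x => (2 : ℝ) • c - x) '' L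

/-- The Banach–Mazur distance. -/
def bmDist {n : ℕ} (K L : Set (Fin n → ℝ)) : ℝ :=
  sInf {r : ℝ | 0 < r ∧ ∃ (T : (Fin n → ℝ) ≃ₗ[ℝ] (Fin n → ℝ)) (u v : Fin n → ℝ),
    (fun x => x + u) '' K ⊆ ⇑T '' ((fun x => x + v) '' L) ∧
    ⇑T '' ((fun x => x + v) '' L) ⊆ r • ((fun x => x + u) '' K)}

/-- The asymmetry constant of a convex body. -/
def asymConst {n : ℕ} (K : Set (Fin n → ℝ)) : ℝ :=
  sInf {r : ℝ | 0 < r ∧ ∃ z ∈ interior K,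
    (fun x => x - z) '' K ⊆ (-r) • ((fun x => x - z) '' K)}

/-- A linear map whose image of the cross-polytope contains a cube of positive radius is
bijective. -/
lemma bijective_of_smul_cube_subset {n : ℕ} {L : (Fin n → ℝ) →ₗ[ℝ] (Fin n → ℝ)} {r : ℝ}
    (hr : 0 < r) (h : r • cube n ⊆ L '' crossPoly n) : Function.Bijective L := by
  have hsurj : Function.Surjective L := by
    intro y
    have hpos : 0 < ‖y‖ + 1 := by positivity
    have hmem : r • ((‖y‖ + 1)⁻¹ • y) ∈ r • cube n := by
      refine Set.smul_mem_smul_set fun i => ?_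
      have hi : |y i| ≤ ‖y‖ := norm_le_pi_norm y i
      rw [Pi.smul_apply, smul_eq_mul, abs_mul, abs_of_pos (inv_pos.2 hpos),
        inv_mul_le_iff₀ hpos]
      linarith
    obtain ⟨x, -, hx⟩ := h hmem
    refine ⟨(‖y‖ + 1) • r⁻¹ • x, ?_⟩
    rw [map_smul, map_smul, hx, inv_smul_smul₀ hr.ne', smul_inv_smul₀ hpos.ne']
  exact ⟨LinearMap.injective_iff_surjective.2 hsurj, hsurj⟩

/-- If the image of the cross-polytope contains `r • cube n`, then every vector `x` is sent to a
vector having a coordinate at least `r` times the `ℓ¹` norm of `x`. -/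
lemma exists_mul_sum_abs_le_abs_apply {n : ℕ} [NeZero n]
    {L : (Fin n → ℝ) →ₗ[ℝ] (Fin n → ℝ)} {r : ℝ}
    (hr : 0 < r) (h : r • cube n ⊆ L '' crossPoly n) (x : Fin n → ℝ) :
    ∃ i, r * ∑ j, |x j| ≤ |L x i| := by
  by_contra! hlt
  have hN : 0 < r * ∑ j, |x j| := (abs_nonneg _).trans_lt (hlt 0)
  have hnorm : ‖L x‖ < r * ∑ j, |x j| := (pi_norm_lt_iff hN).2 hlt
  obtain ⟨s, hs, hsr⟩ := exists_between hnorm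
  have hs0 : 0 < s := (norm_nonneg _).trans_lt hs
  have hmem : r • (s⁻¹ • L x) ∈ r • cube n := by
    refine Set.smul_mem_smul_set fun i => ?_
    have hi : |L x i| ≤ ‖L x‖ := norm_le_pi_norm (L x) i
    rw [Pi.smul_apply, smul_eq_mul, abs_mul, abs_of_pos (inv_pos.2 hs0), inv_mul_le_iff₀ hs0]
    linarith
  obtain ⟨z, hz, hLz⟩ := h hmem
  rw [← map_smul, ← map_smul] at hLz
  obtain rfl := (bijective_of_smul_cube_subset hr h).1 hLz
  have hz' : ∑ j, |r * (s⁻¹ * x j)| ≤ 1 := hz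
  simp only [abs_mul, abs_of_pos hr, abs_of_pos (inv_pos.2 hs0), ← Finset.mul_sum] at hz'
  rw [mul_left_comm, inv_mul_le_iff₀ hs0] at hz'
  linarith

/-- The finite set of sign vectors. -/
def signVectors (n : ℕ) : Finset (Fin n → ℝ) := Fintype.piFinset fun _ => {1, -1}

lemma mem_signVectors {n : ℕ} {ε : Fin n → ℝ} :
    ε ∈ signVectors n ↔ ∀ j, ε j = 1 ∨ ε j = -1 := by
  simp [signVectors]

lemma card_signVectors (n : ℕ) : (signVectors n).card = 2 ^ n := by
  have : ({1, -1} : Finset ℝ).card = 2 := Finset.card_pair (by norm_num)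
  simp [signVectors, this]

/-- A signed sum of four numbers in `[-1, 1]` is at most `2` as soon as one term other than the
one of least absolute value is nonpositive. -/
lemma sum_mul_le_two {t ε : Fin 4 → ℝ} (ht : ∀ j, |t j| ≤ 1)
    (hε : ∀ j, ε j = 1 ∨ ε j = -1) {k : Fin 4} (hk : ∀ j, |t k| ≤ |t j|)
    {j : Fin 4} (hj : j ≠ k) (hneg : ε j * t j = -|t j|) : ∑ i, ε i * t i ≤ 2 := by
  have hle : ∀ i, ε i * t i ≤ |t i| := fun i => by
    rcases hε i with hi | hi <;> simp [hi, le_abs_self, neg_le_abs]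
  have hrest : ∑ i ∈ (Finset.univ.erase j).erase k, ε i * t i ≤ 2 := by
    have hcard : ((Finset.univ.erase j).erase k).card = 2 := by
      rw [Finset.card_erase_of_mem (by simp [hj.symm]), Finset.card_erase_of_mem (by simp)]
      simp
    have := Finset.sum_le_card_nsmul ((Finset.univ.erase j).erase k) (fun i => ε i * t i) 1
      fun i _ => (hle i).trans (ht i)
    simpa [hcard] using this
  rw [← Finset.add_sum_erase _ _ (Finset.mem_univ j),
    ← Finset.add_sum_erase (Finset.univ.erase j) _ (by simp [hj.symm] : k ∈ _)]
  linarith [hk j, hle k]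

/-- At most four signed sums of four numbers in `[-1, 1]` exceed `2` in absolute value. -/
lemma card_two_lt_abs_sum_le {t : Fin 4 → ℝ} (ht : ∀ j, |t j| ≤ 1) :
    ((signVectors 4).filter fun ε => 2 < |∑ j, ε j * t j|).card ≤ 4 := by
  obtain ⟨k, hk⟩ := Finite.exists_min fun j => |t j|
  let σ : Fin 4 → ℝ := fun j => if 0 ≤ t j then 1 else -1
  have key : ∀ ε : Fin 4 → ℝ, (∀ j, ε j = 1 ∨ ε j = -1) → 2 < ∑ j, ε j * t j →
      ∀ j, j ≠ k → ε j = σ j := by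
    intro ε hε h j hj
    by_contra hne
    refine h.not_ge (sum_mul_le_two ht hε hk hj ?_)
    rcases le_or_gt 0 (t j) with h0 | h0 <;> rcases hε j with hi | hi
    · simp [σ, h0, hi] at hne
    · simp [hi, abs_of_nonneg h0]
    · simp [hi, abs_of_neg h0]
    · simp [σ, h0.not_ge, hi] at hne
  let f : ℝ × ℝ → Fin 4 → ℝ := fun p => Function.update (p.1 • σ) k p.2
  have hsub : ((signVectors 4).filter fun ε => 2 < |∑ j, ε j * t j|) ⊆
      ((({1, -1} : Finset ℝ) ×ˢ ({1, -1} : Finset ℝ)).image f) := by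
    intro ε hmem
    obtain ⟨hε, h⟩ := Finset.mem_filter.1 hmem
    rw [mem_signVectors] at hε
    rw [Finset.mem_image]
    rcases lt_abs.1 h with h | h
    · refine ⟨(1, ε k), by simpa using hε k, funext fun j => ?_⟩
      by_cases hj : j = k
      · simp [f, hj]
      · simp [f, hj, key ε hε h j hj]
    · refine ⟨(-1, ε k), by simpa using hε k, funext fun j => ?_⟩
      by_cases hj : j = k
      · simp [f, hj]
      · have hσ := key (-ε) (fun i => by simpa [neg_eq_iff_eq_neg, or_comm] using hε i)
          (by simpa using h) j hj
        simp [f, hj, ← hσ]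
  refine (Finset.card_le_card hsub).trans (Finset.card_image_le.trans ?_)
  rw [Finset.card_product, Finset.card_pair (by norm_num)]

/-- If, in a relation between `A` and `B`, every `a ∈ A` is related to some `b ∈ B`, every `b ∈ B`
to at most `m` elements of `A`, and `#A = #B * m`, then both bounds are equalities. -/
lemma card_bipartite_eq_of_card_eq_mul {α β : Type*} (A : Finset α) (B : Finset β)
    (R : α → β → Prop) [∀ a b, Decidable (R a b)] {m : ℕ}
    (hA : ∀ a ∈ A, 1 ≤ (B.bipartiteAbove R a).card)
    (hB : ∀ b ∈ B, (A.bipartiteBelow R b).card ≤ m) (hcard : A.card = B.card * m) :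
    (∀ a ∈ A, (B.bipartiteAbove R a).card = 1) ∧ ∀ b ∈ B, (A.bipartiteBelow R b).card = m := by
  have hsum := Finset.sum_card_bipartiteAbove_eq_sum_card_bipartiteBelow (s := A) (t := B) R
  have hlow : ∑ _a ∈ A, 1 ≤ ∑ a ∈ A, (B.bipartiteAbove R a).card := Finset.sum_le_sum hA
  have hupp : ∑ b ∈ B, (A.bipartiteBelow R b).card ≤ ∑ _b ∈ B, m := Finset.sum_le_sum hB
  have h1 : ∑ _a ∈ A, 1 = A.card := by simp
  have h2 : ∑ _b ∈ B, m = B.card * m := by simp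
  exact ⟨fun a ha => ((Finset.sum_eq_sum_iff_of_le hA).1 (by lia) a ha).symm,
    (Finset.sum_eq_sum_iff_of_le hB).1 (by lia)⟩

/-- for a `4×4` matrix `T` with entries of absolute value at most `1`
and `r > 1/2` with `r·C₄ ⊆ T(C₄*)`, every sign vector is associated with exactly one
row and every row is associated with exactly `4` sign vectors. -/
theorem stmt10 (T : Matrix (Fin 4) (Fin 4) ℝ) (hT : ∀ i j, |T i j| ≤ 1)
    (r : ℝ) (hr : 1/2 < r)
    (h1 : r • cube 4 ⊆ ⇑(Matrix.toLin' T) '' crossPoly 4) :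
    (∀ ε : Fin 4 → ℝ, (∀ j, ε j = 1 ∨ ε j = -1) →
      ∃! i : Fin 4, 4 * r ≤ |∑ j, ε j * T i j|) ∧
    (∀ i : Fin 4,
      Set.ncard {ε : Fin 4 → ℝ | (∀ j, ε j = 1 ∨ ε j = -1) ∧
        4 * r ≤ |∑ j, ε j * T i j|} = 4) := by
  classical
  have hr0 : 0 < r := by linarith
  obtain ⟨hrow, hcol⟩ := card_bipartite_eq_of_card_eq_mul (signVectors 4)
    (Finset.univ : Finset (Fin 4)) (fun ε i => 4 * r ≤ |∑ j, ε j * T i j|) (m := 4)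
    (fun ε hε => by
      rw [mem_signVectors] at hε
      obtain ⟨i, hi⟩ := exists_mul_sum_abs_le_abs_apply hr0 h1 ε
      have habs : ∀ j, |ε j| = 1 := fun j => by rcases hε j with h | h <;> simp [h]
      refine Finset.card_pos.2 ⟨i, ?_⟩
      simpa [Finset.bipartiteAbove, habs, Matrix.mulVec, dotProduct, mul_comm] using hi)
    (fun i _ => by
      refine (Finset.card_le_card fun ε hε => ?_).trans (card_two_lt_abs_sum_le (hT i))
      rw [Finset.mem_bipartiteBelow] at hε
      exact Finset.mem_filter.2 ⟨hε.1, by linarith [hε.2]⟩)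
    (by rw [card_signVectors]; simp)
  refine ⟨fun ε hε => ?_, fun i => ?_⟩
  · obtain ⟨i, hi⟩ := Finset.card_eq_one.1 (hrow ε (mem_signVectors.2 hε))
    have hiff : ∀ i', 4 * r ≤ |∑ j, ε j * T i' j| ↔ i' = i := fun i' => by
      simpa [Finset.bipartiteAbove] using Finset.ext_iff.1 hi i'
    exact ⟨i, (hiff i).2 rfl, fun i' => (hiff i').1⟩
  · refine Eq.trans ?_ (hcol i (Finset.mem_univ i))
    rw [← Set.ncard_coe_finset]
    congr 1
    ext ε
    simp [Finset.bipartiteBelow, mem_signVectors]
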